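/- Let n, k, d_low ∈ N and let Σ ∈ R^{n×n} be positive definite with eigenvalues λ₁ ≤ ... ≤ λ_n. Then there exists a diagonal matrix D̃ with 0 ≺ D̃ ⪯ I_n such that: (1) the number of indices i with D̃_{ii} ≠ 1 is at most 128 · d_low · k², and (2) for every v ∈ R^n with ‖D̃^{1/2}v‖₂ ≤ (k/2)‖D̃^{1/2}v‖_∞, it holds that ‖D̃^{1/2}v‖₂ ≤ 4k · λ_{d_low+1}^{-1/2} · ‖v‖_Σ, where ‖v‖_Σ = √(vᵀΣv). -/

import Mathlib

open Matrix

/-- Maximal weights in `(0, 1]` subject to a ridge leverage bound: every coordinate whose weight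
is not `1` nearly saturates the bound. -/
theorem exists_maximal_weights {ι : Type*} [Fintype ι] {a μ : ℝ} (ha : 0 ≤ a) (hμ : 0 < μ)
    (q : (ι → ℝ) → ℝ) (hq : ∀ v i, μ * v i ^ 2 ≤ q v) :
    ∃ D : ι → ℝ, (∀ i, 0 < D i ∧ D i ≤ 1) ∧
      (∀ i v, D i * v i ^ 2 ≤ a * ∑ j, D j * v j ^ 2 + q v) ∧
      ∀ i, D i ≠ 1 → ∃ v, a * ∑ j, D j * v j ^ 2 + q v < 2 * D i * v i ^ 2 := by
  classical
  set F : Set (ι → ℝ) := Set.pi Set.univ (fun _ => Set.Icc (0 : ℝ) 1) ∩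
    {D | ∀ i v, D i * v i ^ 2 ≤ a * ∑ j, D j * v j ^ 2 + q v}
  have hcomp : IsCompact F := by
    refine (isCompact_univ_pi fun _ => isCompact_Icc).inter_right ?_
    simp only [Set.ofPred_forall]
    refine isClosed_iInter fun i => isClosed_iInter fun v => ?_
    exact isClosed_le (by fun_prop) (by fun_prop)
  have hne : F.Nonempty := by
    refine ⟨0, fun i _ => by simp, fun i v => ?_⟩
    have := hq v i
    have : 0 ≤ μ * v i ^ 2 := by positivity
    simp only [Pi.zero_apply, zero_mul, Finset.sum_const_zero, mul_zero, zero_add]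
    linarith
  obtain ⟨D, ⟨hD01, hDle⟩, hmax⟩ := hcomp.exists_isMaxOn hne
    (f := fun D : ι → ℝ => ∑ i, D i) (by fun_prop)
  have h01 : ∀ i, 0 ≤ D i ∧ D i ≤ 1 := fun i => hD01 i (Set.mem_univ i)
  have key : ∀ i, ∀ ε, 0 < ε → D i + ε ≤ 1 →
      ∃ v, a * ∑ j, D j * v j ^ 2 + q v < (D i + ε) * v i ^ 2 := by
    intro i ε hε hle
    by_contra! hcon
    have hsum : ∀ g : ι → ℝ, ∑ j, (D + Pi.single i ε : ι → ℝ) j * g j = ∑ j, D j * g j + ε * g i := by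
      intro g
      simp [add_mul, Finset.sum_add_distrib, Pi.single_apply, ite_mul]
    have hmem : D + Pi.single i ε ∈ F := by
      refine ⟨fun j _ => ?_, fun j v => ?_⟩
      · rcases eq_or_ne j i with rfl | hj
        · simpa using ⟨by linarith [(h01 j).1], hle⟩
        · simpa [hj] using h01 j
      · rw [hsum fun j => v j ^ 2]
        have h0 : 0 ≤ a * (ε * v i ^ 2) := by positivity
        rcases eq_or_ne j i with rfl | hj
        · have := hcon v
          simp only [Pi.add_apply, Pi.single_eq_same]
          linarith
        · have := hDle j v
          simp only [Pi.add_apply, Pi.single_eq_of_ne hj, add_zero]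
          linarith
    have h1 := hmax hmem
    have h2 := hsum fun _ => 1
    simp only [mul_one, Set.mem_ofPred_eq] at h1 h2
    linarith
  have hpos : ∀ i, 0 < D i := by
    intro i
    refine (h01 i).1.lt_of_ne fun h0 => ?_
    obtain ⟨v, hv⟩ := key i (min μ 1) (by positivity) (by rw [← h0]; simp)
    have h1 := hq v i
    have h2 : 0 ≤ a * ∑ j, D j * v j ^ 2 :=
      mul_nonneg ha (Finset.sum_nonneg fun j _ => mul_nonneg (h01 j).1 (sq_nonneg _))
    have h3 : min μ 1 * v i ^ 2 ≤ μ * v i ^ 2 := by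
      gcongr
      exact min_le_left _ _
    rw [← h0, zero_add] at hv
    linarith
  refine ⟨D, fun i => ⟨hpos i, (h01 i).2⟩, hDle, fun i hi => ?_⟩
  have hlt : D i < 1 := (h01 i).2.lt_of_ne hi
  obtain ⟨v, hv⟩ := key i (min (D i) (1 - D i)) (lt_min (hpos i) (by linarith))
    (by linarith [min_le_right (D i) (1 - D i)])
  refine ⟨v, hv.trans_le ?_⟩
  gcongr
  linarith [min_le_left (D i) (1 - D i)]

/-- At most `dim K / τ` coordinates have leverage at least `τ` with respect to a subspace `K`. -/
theorem mul_card_le_finrank_of_leverage {ι : Type*} [Fintype ι]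
    (K : Submodule ℝ (EuclideanSpace ℝ ι)) (H : Finset ι) {τ : ℝ}
    (hH : ∀ i ∈ H, ∃ u ∈ K, τ * ‖u‖ ^ 2 < u i ^ 2) :
    τ * H.card ≤ Module.finrank ℝ K := by
  classical
  set b := stdOrthonormalBasis ℝ K
  have hlev : ∀ i ∈ H, τ ≤ ∑ j, ((b j : EuclideanSpace ℝ ι) i) ^ 2 := by
    intro i hi
    obtain ⟨u, hu, hlt⟩ := hH i hi
    set x : K := ⟨u, hu⟩ with hx
    have hnorm : ‖u‖ ^ 2 = ∑ j, (b.repr x j) ^ 2 := by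
      rw [← EuclideanSpace.real_norm_sq_eq, b.repr.norm_map]
      rfl
    have hcoord : u i = ∑ j, b.repr x j * (b j : EuclideanSpace ℝ ι) i := by
      have h := congrArg (fun y : K => (y : EuclideanSpace ℝ ι) i) (b.sum_repr x)
      simpa [hx] using h.symm
    have hcs := Finset.sum_mul_sq_le_sq_mul_sq Finset.univ (fun j => b.repr x j)
      (fun j => (b j : EuclideanSpace ℝ ι) i)
    rw [← hcoord, ← hnorm] at hcs
    by_contra! hcon
    nlinarith [mul_le_mul_of_nonneg_left hcon.le (sq_nonneg ‖u‖)]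
  calc τ * H.card = ∑ _i ∈ H, τ := by simp [mul_comm]
    _ ≤ ∑ i ∈ H, ∑ j, ((b j : EuclideanSpace ℝ ι) i) ^ 2 := Finset.sum_le_sum hlev
    _ ≤ ∑ i, ∑ j, ((b j : EuclideanSpace ℝ ι) i) ^ 2 :=
        Finset.sum_le_univ_sum_of_nonneg fun i => Finset.sum_nonneg fun j _ => sq_nonneg _
    _ = ∑ j, ∑ i, ((b j : EuclideanSpace ℝ ι) i) ^ 2 := Finset.sum_comm
    _ = ∑ j, (1 : ℝ) := by
        refine Finset.sum_congr rfl fun j _ => ?_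
        rw [← EuclideanSpace.real_norm_sq_eq, ← Submodule.coe_norm, b.orthonormal.1 j, one_pow]
    _ = Module.finrank ℝ K := by simp

/-- The weighted form of `mul_card_le_finrank_of_leverage`. -/
theorem mul_card_le_finrank_of_weighted_leverage {ι : Type*} [Fintype ι]
    (K : Submodule ℝ (ι → ℝ)) (D : ι → ℝ) (hD : ∀ i, 0 ≤ D i) (H : Finset ι) {τ : ℝ}
    (hH : ∀ i ∈ H, ∃ u ∈ K, τ * ∑ j, D j * u j ^ 2 < D i * u i ^ 2) :
    τ * H.card ≤ Module.finrank ℝ K := by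
  classical
  set L : (ι → ℝ) →ₗ[ℝ] EuclideanSpace ℝ ι :=
    (WithLp.linearEquiv 2 ℝ (ι → ℝ)).symm.toLinearMap ∘ₗ
      LinearMap.pi fun i => √(D i) • LinearMap.proj i with hL
  have hLi : ∀ u i, (L u i) ^ 2 = D i * u i ^ 2 := by
    intro u i
    simp [hL, mul_pow, Real.sq_sqrt (hD i)]
  refine (mul_card_le_finrank_of_leverage (K.map L) H (τ := τ) fun i hi => ?_).trans
    (by exact_mod_cast Submodule.finrank_map_le L K)
  obtain ⟨u, hu, hlt⟩ := hH i hi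
  refine ⟨L u, Submodule.mem_map_of_mem hu, ?_⟩
  simpa only [EuclideanSpace.real_norm_sq_eq, hLi] using hlt

/-- Up to the span of the `d` lowest eigenvectors, the quadratic form of a symmetric positive
matrix is bounded below by its `(d + 1)`-st eigenvalue. -/
theorem exists_submodule_mul_sum_sq_sub_le {n : ℕ} {S : Matrix (Fin n) (Fin n) ℝ}
    (hS : S.PosDef) (σ : Equiv.Perm (Fin n)) (hmono : Monotone (hS.1.eigenvalues ∘ σ))
    (d : Fin n) :
    ∃ K : Submodule ℝ (Fin n → ℝ), Module.finrank ℝ K ≤ d ∧ ∀ v, ∃ u ∈ K,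
      hS.1.eigenvalues (σ d) * ∑ i, (v i - u i) ^ 2 ≤ v ⬝ᵥ S.mulVec v := by
  classical
  set b := hS.1.eigenvectorBasis.reindex σ.symm with hb
  set e : Fin n → Fin n → ℝ := fun j => WithLp.ofLp (b j) with he
  have hSe : ∀ j, S *ᵥ e j = hS.1.eigenvalues (σ j) • e j := by
    intro j
    simpa [he, hb] using hS.1.mulVec_eigenvectorBasis (σ j)
  have hee : ∀ i j, e i ⬝ᵥ e j = if i = j then 1 else 0 := by
    intro i j
    have h := orthonormal_iff_ite.mp b.orthonormal j i
    rw [EuclideanSpace.inner_eq_star_dotProduct] at h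
    simpa [he, eq_comm] using h
  refine ⟨Submodule.span ℝ ((Finset.Iio d).image e : Finset (Fin n → ℝ)), ?_, fun v => ?_⟩
  · refine (finrank_span_finset_le_card _).trans (Finset.card_image_le.trans ?_)
    simp
  set c : Fin n → ℝ := fun j => b.repr (WithLp.toLp 2 v) j with hc
  have hv : v = ∑ j, c j • e j := by
    have h := congrArg WithLp.ofLp (b.sum_repr (WithLp.toLp 2 v))
    simpa [he, hc] using h.symm
  refine ⟨∑ j ∈ Finset.Iio d, c j • e j, Submodule.sum_mem _ fun j hj =>
    Submodule.smul_mem _ _ (Submodule.subset_span (by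
      simpa using ⟨j, by simpa using hj, rfl⟩)), ?_⟩
  have hdot : ∀ (s t : Finset (Fin n)) (x y : Fin n → ℝ),
      (∑ j ∈ s, x j • e j) ⬝ᵥ (∑ j ∈ t, y j • e j) = ∑ j ∈ s ∩ t, x j * y j := by
    intro s t x y
    simp [sum_dotProduct, dotProduct_sum, hee, Finset.sum_ite_mem, Finset.inter_comm, mul_comm]
  have hquad : v ⬝ᵥ S *ᵥ v = ∑ j, hS.1.eigenvalues (σ j) * c j ^ 2 := by
    have h : S *ᵥ v = ∑ j, (c j * hS.1.eigenvalues (σ j)) • e j := by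
      conv_lhs => rw [hv]
      simp [Matrix.mulVec_sum, Matrix.mulVec_smul, hSe, smul_smul]
    rw [h]
    conv_lhs => rw [hv]
    rw [hdot]
    simp only [Finset.inter_self]
    exact Finset.sum_congr rfl fun j _ => by ring
  have hdiff : v - ∑ j ∈ Finset.Iio d, c j • e j = ∑ j ∈ Finset.Ici d, c j • e j := by
    conv_lhs => rw [hv]
    rw [sub_eq_iff_eq_add, ← Finset.sum_union]
    · refine Finset.sum_congr ?_ fun _ _ => rfl
      ext j
      simpa using le_or_gt d j
    · rw [Finset.disjoint_left]
      intro j hj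
      simpa using hj
  have hsq : ∑ i, (v i - (∑ j ∈ Finset.Iio d, c j • e j) i) ^ 2 = ∑ j ∈ Finset.Ici d, c j ^ 2 := by
    have h := hdot (Finset.Ici d) (Finset.Ici d) c c
    rw [← hdiff, Finset.inter_self] at h
    simpa only [dotProduct, Pi.sub_apply, pow_two] using h
  rw [hsq, hquad, Finset.mul_sum]
  calc ∑ j ∈ Finset.Ici d, hS.1.eigenvalues (σ d) * c j ^ 2
      ≤ ∑ j ∈ Finset.Ici d, hS.1.eigenvalues (σ j) * c j ^ 2 :=
        Finset.sum_le_sum fun j hj => mul_le_mul_of_nonneg_right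
          (hmono (Finset.mem_Ici.mp hj)) (sq_nonneg _)
    _ ≤ _ := Finset.sum_le_univ_sum_of_nonneg fun j =>
        mul_nonneg (hS.eigenvalues_pos _).le (sq_nonneg _)

/-- A coordinate that is heavy for a vector `v` is heavy for any approximation `u` of `v`, when
the approximation error is charged to the right-hand side. -/
theorem leverage_of_approx {ι : Type*} [Fintype ι] {D u v : ι → ℝ} {a : ℝ}
    (hD : ∀ i, 0 < D i ∧ D i ≤ 1) (ha : 0 ≤ a) (ha2 : a ≤ 2) (i : ι)
    (h : a * ∑ j, D j * v j ^ 2 + 32 * ∑ j, (v j - u j) ^ 2 < 2 * D i * v i ^ 2) :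
    a / 8 * ∑ j, D j * u j ^ 2 < D i * u i ^ 2 := by
  set z := ∑ j, (v j - u j) ^ 2 with hz
  have hz0 : 0 ≤ z := Finset.sum_nonneg fun j _ => sq_nonneg _
  have hzi : (v i - u i) ^ 2 ≤ z :=
    Finset.single_le_sum (f := fun j => (v j - u j) ^ 2) (fun j _ => sq_nonneg _)
      (Finset.mem_univ i)
  have hDz : D i * (v i - u i) ^ 2 ≤ z :=
    (mul_le_of_le_one_left (sq_nonneg _) (hD i).2).trans hzi
  have hvi : D i * v i ^ 2 ≤ 2 * (D i * u i ^ 2) + 2 * (D i * (v i - u i) ^ 2) := by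
    nlinarith [mul_nonneg (hD i).1.le (sq_nonneg (v i - 2 * u i))]
  have hu : ∑ j, D j * u j ^ 2 ≤ 2 * ∑ j, D j * v j ^ 2 + 2 * z := by
    rw [hz, Finset.mul_sum, Finset.mul_sum, ← Finset.sum_add_distrib]
    refine Finset.sum_le_sum fun j _ => ?_
    have h1 : D j * (v j - u j) ^ 2 ≤ (v j - u j) ^ 2 :=
      mul_le_of_le_one_left (sq_nonneg _) (hD j).2
    nlinarith [mul_nonneg (hD j).1.le (sq_nonneg (2 * v j - u j))]
  nlinarith [mul_le_mul_of_nonneg_left hu ha, mul_le_mul_of_nonneg_right ha2 hz0]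

/-- Existence of a good rescaling for a covariance with few small eigenvalues: there is a
diagonal matrix D̃ with 0 ≺ D̃ ⪯ I, at most 128·d_low·k² entries different from 1, such
that every D̃-quantitatively-sparse vector v (i.e. ‖D̃^{1/2}v‖₂ ≤ (k/2)‖D̃^{1/2}v‖_∞)
satisfies ‖D̃^{1/2}v‖₂ ≤ 4k λ_{d_low+1}^{-1/2} ‖v‖_Σ. -/
theorem stmt17 {n k dlow : ℕ} (hdlow : dlow < n)
    (S : Matrix (Fin n) (Fin n) ℝ) (hS : S.PosDef)
    (lam : Fin n → ℝ) (σ : Equiv.Perm (Fin n))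
    (hlam : lam = hS.1.eigenvalues ∘ σ) (hmono : Monotone lam) :
    ∃ dt : Fin n → ℝ, (∀ i, 0 < dt i ∧ dt i ≤ 1) ∧
      ({i | dt i ≠ 1} : Set (Fin n)).ncard ≤ 128 * dlow * k^2 ∧
      ∀ v : Fin n → ℝ,
        Real.sqrt (∑ i, dt i * v i ^ 2) ≤ (k/2) * ⨆ i, Real.sqrt (dt i) * |v i| →
        Real.sqrt (∑ i, dt i * v i ^ 2) ≤
          4 * k * (Real.sqrt (lam ⟨dlow, hdlow⟩))⁻¹ * Real.sqrt (v ⬝ᵥ S.mulVec v) := by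
  classical
  subst hlam
  rcases Nat.eq_zero_or_pos k with rfl | hk
  · refine ⟨fun _ => 1, by simp, by simp, fun v hv => ?_⟩
    simpa using hv
  have hk1 : (1 : ℝ) ≤ k := by exact_mod_cast hk
  have hn : 0 < n := by omega
  have : Nonempty (Fin n) := ⟨⟨0, hn⟩⟩
  set lamd := (hS.1.eigenvalues ∘ σ) ⟨dlow, hdlow⟩
  have hlpos : 0 < lamd := hS.eigenvalues_pos _
  have hμpos : 0 < hS.1.eigenvalues (σ ⟨0, hn⟩) := hS.eigenvalues_pos _
  obtain ⟨K, hKd, hK⟩ := exists_submodule_mul_sum_sq_sub_le hS σ hmono ⟨dlow, hdlow⟩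
  have hlow : ∀ (v : Fin n → ℝ) i,
      hS.1.eigenvalues (σ ⟨0, hn⟩) * v i ^ 2 ≤ v ⬝ᵥ S.mulVec v := by
    obtain ⟨K₀, hK₀d, hK₀⟩ := exists_submodule_mul_sum_sq_sub_le hS σ hmono ⟨0, hn⟩
    have hbot : K₀ = ⊥ := Submodule.finrank_eq_zero.mp (Nat.le_zero.mp hK₀d)
    intro v i
    obtain ⟨u, hu, hle⟩ := hK₀ v
    rw [hbot, Submodule.mem_bot] at hu
    subst hu
    refine le_trans (mul_le_mul_of_nonneg_left ?_ hμpos.le) hle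
    simpa using Finset.single_le_sum (f := fun j => v j ^ 2) (fun j _ => sq_nonneg _)
      (Finset.mem_univ i)
  have ha : (0 : ℝ) ≤ 2 / k ^ 2 := by positivity
  have ha2 : (2 : ℝ) / k ^ 2 ≤ 2 := div_le_self (by norm_num) (one_le_pow₀ hk1)
  obtain ⟨D, hD, hle, hheavy⟩ := exists_maximal_weights ha
    (show 0 < 32 / lamd * hS.1.eigenvalues (σ ⟨0, hn⟩) by positivity)
    (fun v => 32 / lamd * (v ⬝ᵥ S.mulVec v)) (fun v i => by
      rw [mul_assoc]
      exact mul_le_mul_of_nonneg_left (hlow v i) (by positivity))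
  refine ⟨D, hD, ?_, fun v hv => ?_⟩
  · have hcard := mul_card_le_finrank_of_weighted_leverage K D (fun i => (hD i).1.le)
      (Finset.univ.filter fun i => D i ≠ 1) (τ := 2 / k ^ 2 / 8) (by
        intro i hi
        obtain ⟨v, hv⟩ := hheavy i (Finset.mem_filter.mp hi).2
        obtain ⟨u, hu, hvu⟩ := hK v
        refine ⟨u, hu, leverage_of_approx hD ha ha2 i (lt_of_le_of_lt ?_ hv)⟩
        have h : 32 / lamd * (lamd * ∑ j, (v j - u j) ^ 2) ≤ 32 / lamd * (v ⬝ᵥ S.mulVec v) :=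
          mul_le_mul_of_nonneg_left hvu (by positivity)
        rw [← mul_assoc, div_mul_cancel₀ _ hlpos.ne'] at h
        linarith)
    have hset : ({i | D i ≠ 1} : Set (Fin n)) =
        ((Finset.univ.filter fun i => D i ≠ 1 : Finset (Fin n)) : Set (Fin n)) := by
      ext i
      simp
    rw [hset, Set.ncard_coe_finset]
    set N := (Finset.univ.filter fun i => D i ≠ 1).card
    have hKd' : (Module.finrank ℝ K : ℝ) ≤ dlow := by exact_mod_cast hKd
    have h4 : (N : ℝ) ≤ 4 * dlow * k ^ 2 := by
      have h := hcard.trans hKd'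
      field_simp at h
      linarith
    have h4' : N ≤ 4 * dlow * k ^ 2 := by exact_mod_cast h4
    nlinarith [Nat.zero_le (dlow * k ^ 2)]
  · set W := ∑ i, D i * v i ^ 2
    have hW : 0 ≤ W := Finset.sum_nonneg fun i _ => mul_nonneg (hD i).1.le (sq_nonneg _)
    have hQ : 0 ≤ v ⬝ᵥ S.mulVec v :=
      (mul_nonneg hμpos.le (sq_nonneg _)).trans (hlow v ⟨0, hn⟩)
    obtain ⟨i, hi⟩ := exists_eq_ciSup_of_finite (f := fun i => √(D i) * |v i|)
    rw [← hi] at hv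
    have hWi : W ≤ k ^ 2 / 4 * (D i * v i ^ 2) := by
      have h := pow_le_pow_left₀ (Real.sqrt_nonneg _) hv 2
      rw [Real.sq_sqrt hW, mul_pow, mul_pow, Real.sq_sqrt (hD i).1.le, sq_abs] at h
      linarith
    have hWQ : W ≤ (4 * k) ^ 2 * (lamd⁻¹ * (v ⬝ᵥ S.mulVec v)) := by
      have h := mul_le_mul_of_nonneg_left (hle i v) (show (0 : ℝ) ≤ k ^ 2 / 4 by positivity)
      have e : (k : ℝ) ^ 2 / 4 * (2 / k ^ 2 * W + 32 / lamd * (v ⬝ᵥ S.mulVec v)) =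
          W / 2 + 8 * k ^ 2 * (lamd⁻¹ * (v ⬝ᵥ S.mulVec v)) := by
        field_simp
        ring
      linarith
    calc √W ≤ √((4 * k) ^ 2 * (lamd⁻¹ * (v ⬝ᵥ S.mulVec v))) := Real.sqrt_le_sqrt hWQ
      _ = 4 * k * (√lamd)⁻¹ * √(v ⬝ᵥ S.mulVec v) := by
        rw [Real.sqrt_mul (by positivity), Real.sqrt_sq (by positivity),
          Real.sqrt_mul (by positivity), Real.sqrt_inv, mul_assoc (4 * (k : ℝ))]
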